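/- For any word u of length n, the sum over all runs v in u of the cardinalities |H(v)| of their handle sets is at most n − 1. -/

import Mathlib

open scoped Classical

namespace RunsExp

variable {α : Type*}

/-- `p` is a period of the word `w`. -/
def IsPeriod (w : List α) (p : ℕ) : Prop :=
  0 < p ∧ ∀ i : ℕ, i + p < w.length → w[i]? = w[i + p]?

/-- The shortest period of the word `w`. -/
noncomputable def minPeriod (w : List α) : ℕ := sInf {p | IsPeriod w p}

/-- The factor `u[i..j]` of `u` (0-based indices, inclusive on both ends). -/
def factor (u : List α) (i j : ℕ) : List α := (u.drop i).take (j - i + 1)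

/-- `[i..j]` is a run in `u` (0-based indices): the shortest period `p` of `u[i..j]`
satisfies `2p ≤ j-i+1` and the interval can be extended neither to the left nor to
the right without violating this property. -/
def IsRun (u : List α) (i j : ℕ) : Prop :=
  i ≤ j ∧ j < u.length ∧
  2 * minPeriod (factor u i j) ≤ j - i + 1 ∧
  (i = 0 ∨ u[i - 1]? ≠ u[i + minPeriod (factor u i j) - 1]?) ∧
  (j = u.length - 1 ∨ u[j - minPeriod (factor u i j) + 1]? ≠ u[j + 1]?)

/-- The exponent of the run `[i..j]` of `u`. -/
noncomputable def exponent (u : List α) (i j : ℕ) : ℚ :=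
  ((j : ℚ) - (i : ℚ) + 1) / (minPeriod (factor u i j) : ℚ)

/-- The set of all runs of `u`, as a finset of pairs of indices. -/
noncomputable def runs (u : List α) : Finset (ℕ × ℕ) :=
  (Finset.range u.length ×ˢ Finset.range u.length).filter fun q => IsRun u q.1 q.2

/-- The sum of exponents of all runs in `u`. -/
noncomputable def sigma (u : List α) : ℚ :=
  ∑ q ∈ runs u, exponent u q.1 q.2

/-- The lexicographically minimal word cyclically equivalent to `w`. -/
noncomputable def minRot [LinearOrder α] (w : List α) : List α :=
  ((List.range w.length).map w.rotate).foldr min w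

/-- The lexicographically maximal word cyclically equivalent to `w`. -/
noncomputable def maxRot [LinearOrder α] (w : List α) : List α :=
  ((List.range w.length).map w.rotate).foldr max w

/-- The word `x` occurs in `u` at (0-based) starting position `s`, entirely within
the interval `[i..j]`. -/
def OccursAt (u : List α) (i j : ℕ) (x : List α) (s : ℕ) : Prop :=
  i ≤ s ∧ s + x.length ≤ j + 1 ∧ factor u s (s + x.length - 1) = x

/-- `s` and `s'` are starting positions of consecutive occurrences of `x`
inside the interval `[i..j]` of `u`. -/
def ConsecutiveOcc (u : List α) (i j : ℕ) (x : List α) (s s' : ℕ) : Prop :=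
  OccursAt u i j x s ∧ OccursAt u i j x s' ∧ s < s' ∧
    ∀ t, s < t → t < s' → ¬ OccursAt u i j x t

/-- The set of handles of the run `[i..j]` of `u`: inter-position `k` lies between
the letters at positions `k` and `k+1`.  If the minimal and maximal rotations of the
period-prefix `w` coincide, all inter-positions inside the run are handles; otherwise
the handles are the inter-positions between consecutive occurrences of the minimal
rotation and between consecutive occurrences of the maximal rotation. -/
noncomputable def handles [LinearOrder α] (u : List α) (i j : ℕ) : Set ℕ :=
  let p := minPeriod (factor u i j)
  let w := factor u i (i + p - 1)
  if minRot w = maxRot w then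
    {k | i ≤ k ∧ k < j}
  else
    {k | ∃ s s', (ConsecutiveOcc u i j (minRot w) s s' ∨
                  ConsecutiveOcc u i j (maxRot w) s s') ∧ k = s' - 1}

/-- `[i..j]` is a cubic run in `u`. -/
def IsCubicRun (u : List α) (i j : ℕ) : Prop :=
  IsRun u i j ∧ 3 * minPeriod (factor u i j) ≤ j - i + 1

/-- The set of all cubic runs of `u`. -/
noncomputable def cubicRuns (u : List α) : Finset (ℕ × ℕ) :=
  (Finset.range u.length ×ˢ Finset.range u.length).filter fun q => IsCubicRun u q.1 q.2

/-- The sum of exponents of all cubic runs in `u`. -/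
noncomputable def sigmaCubic (u : List α) : ℚ :=
  ∑ q ∈ cubicRuns u, exponent u q.1 q.2




theorem minPeriod_spec (w : List α) (hw : w ≠ []) : IsPeriod w (minPeriod w) := by
  have : (w.length) ∈ {p | IsPeriod w p} :=
    ⟨List.length_pos_iff.mpr hw, fun i hi => by omega⟩
  exact Nat.sInf_mem ⟨_, this⟩

theorem factor_getElem? (u : List α) (i j t : ℕ) (h : t < j - i + 1) :
    (factor u i j)[t]? = u[i + t]? := by
  simp [factor, List.getElem?_take, h]

theorem factor_length (u : List α) (i j : ℕ) (hij : i ≤ j) (hj : j < u.length) :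
    (factor u i j).length = j - i + 1 := by
  simp [factor]; omega

theorem run_period {u : List α} {i j : ℕ} (h : IsRun u i j) :
    0 < minPeriod (factor u i j) ∧ ∀ t, i ≤ t → t + minPeriod (factor u i j) ≤ j →
      u[t]? = u[t + minPeriod (factor u i j)]? := by
  obtain ⟨hij, hj, -⟩ := h
  have hl := factor_length u i j hij hj
  have hs := minPeriod_spec (factor u i j) (by
    intro h0; rw [h0] at hl; simp at hl)
  refine ⟨hs.1, fun t ht htj => ?_⟩
  have := hs.2 (t - i) (by omega)
  rw [factor_getElem? _ _ _ _ (by omega), factor_getElem? _ _ _ _ (by omega)] at this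
  rw [show i + (t - i) = t by omega] at this
  rw [this]; congr 1; omega

/-- No proper nonempty border. -/
def Unbordered (x : List α) : Prop :=
  ∀ q, 0 < q → q < x.length → ¬ ∀ t < q, x[t]? = x[x.length - q + t]?

theorem run_mod {u : List α} {i j : ℕ} (h : IsRun u i j) (t : ℕ) (ht : i + t ≤ j) :
    u[i + t]? = u[i + t % minPeriod (factor u i j)]? := by
  obtain ⟨hp, hper⟩ := run_period h
  induction t using Nat.strong_induction_on with
  | _ t ih =>
    rcases lt_or_ge t (minPeriod (factor u i j)) with hlt | hge
    · rw [Nat.mod_eq_of_lt hlt]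
    · rw [Nat.mod_eq_sub_mod hge, ← ih (t - minPeriod (factor u i j)) (by omega) (by omega),
        hper (i + (t - minPeriod (factor u i j))) (by omega) (by omega)]
      congr 1; omega

theorem run_primitive {u : List α} {i j : ℕ} (h : IsRun u i j) (q : ℕ) (hq : 0 < q)
    (hqp : q < minPeriod (factor u i j)) :
    (factor u i (i + minPeriod (factor u i j) - 1)).rotate q ≠
      factor u i (i + minPeriod (factor u i j) - 1) := by
  intro hrot
  obtain ⟨hp, hper⟩ := run_period h
  have hmod := run_mod h
  have h2 := h.2.2.1
  have hij := h.1
  have hj := h.2.1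
  have hnot : ¬ IsPeriod (factor u i j) q := fun hh => by
    have : minPeriod (factor u i j) ≤ q := Nat.sInf_le hh
    omega
  apply hnot
  refine ⟨hq, fun t ht => ?_⟩
  rw [factor_length u i j hij hj] at ht
  rw [factor_getElem? _ _ _ _ (by omega), factor_getElem? _ _ _ _ (by omega)]
  generalize minPeriod (factor u i j) = p at *
  have hwl := factor_length u i (i + p - 1) (by omega) (by omega)
  rw [hmod t (by omega), hmod (t + q) (by omega)]
  have hlt : t % p < p := Nat.mod_lt _ hp
  have hlt2 : (t + q) % p < p := Nat.mod_lt _ hp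
  have e := congrArg (fun l => l[t % p]?) hrot
  rw [List.getElem?_rotate (by omega), hwl, show i + p - 1 - i + 1 = p by omega,
    Nat.mod_add_mod,
    factor_getElem? _ _ _ _ (by omega), factor_getElem? _ _ _ _ (by omega)] at e
  exact e.symm

section ord
variable [LinearOrder α]

theorem append_lt_of_lt (y z b : List α) (hl : y.length = z.length) (h : y < z) :
    y ++ b < z ++ b := by
  induction y generalizing z with
  | nil =>
    cases z with
    | nil => exact absurd h (lt_irrefl _)
    | cons => simp at hl
  | cons a y ih =>
    cases z with
    | nil => simp at hl
    | cons c z =>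
      rw [List.cons_lt_cons_iff] at h
      simp only [List.cons_append]
      rw [List.cons_lt_cons_iff]
      rcases h with h | ⟨h, h'⟩
      · exact Or.inl h
      · exact Or.inr ⟨h, ih z (by simpa using hl) h'⟩

theorem append_left_lt' (y z b : List α) (h : y < z) : b ++ y < b ++ z := by
  induction b with
  | nil => simpa
  | cons a b ih =>
    simp only [List.cons_append]
    rw [List.cons_lt_cons_iff]
    exact Or.inr ⟨rfl, ih⟩

theorem border_decomp (x : List α) (q : ℕ) (hqx : q < x.length)
    (hb : ∀ t < q, x[t]? = x[x.length - q + t]?) :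
    x.take q = x.drop (x.length - q) := by
  apply List.ext_getElem?
  intro t
  rw [List.getElem?_take, List.getElem?_drop]
  split_ifs with h
  · exact hb t h
  · symm; rw [List.getElem?_eq_none_iff]; omega

theorem unbordered_of_extremal (x : List α)
    (hprim : ∀ q, 0 < q → q < x.length → x.rotate q ≠ x)
    (hx : (∀ q, x ≤ x.rotate q) ∨ (∀ q, x.rotate q ≤ x)) : Unbordered x := by
  intro q hq hqx hb
  have hbd := border_decomp x q hqx hb
  apply hprim q hq hqx
  obtain ⟨b, hbdef⟩ : ∃ b, b = x.take q := ⟨_, rfl⟩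
  obtain ⟨y, hydef⟩ : ∃ y, y = x.drop q := ⟨_, rfl⟩
  obtain ⟨z, hzdef⟩ : ∃ z, z = x.take (x.length - q) := ⟨_, rfl⟩
  have e1 : x = b ++ y := by rw [hbdef, hydef, List.take_append_drop]
  have e2 : x = z ++ b := by rw [hbdef, hbd, hzdef, List.take_append_drop]
  have r1 : x.rotate q = y ++ b := by
    rw [List.rotate_eq_drop_append_take hqx.le, hbdef, hydef]
  have r2 : x.rotate (x.length - q) = b ++ z := by
    rw [List.rotate_eq_drop_append_take (by omega), ← hbd, hbdef, hzdef]
  have hl : y.length = z.length := by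
    rw [hydef, hzdef]; simp
  have hyz : y = z := by
    rcases hx with hx | hx
    · have h1 := hx q
      have h2 := hx (x.length - q)
      rw [r1] at h1
      rw [r2] at h2
      rcases lt_trichotomy y z with h | h | h
      · exact absurd (append_lt_of_lt y z b hl h) (by rw [← e2]; exact not_lt.mpr h1)
      · exact h
      · exact absurd (append_left_lt' z y b h) (by rw [← e1]; exact not_lt.mpr h2)
    · have h1 := hx q
      have h2 := hx (x.length - q)
      rw [r1] at h1
      rw [r2] at h2
      rcases lt_trichotomy y z with h | h | h
      · exact absurd (append_left_lt' y z b h) (by rw [← e1]; exact not_lt.mpr h2)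
      · exact h
      · exact absurd (append_lt_of_lt z y b hl.symm h) (by rw [← e2]; exact not_lt.mpr h1)
  rw [r1, hyz, ← e2]

theorem foldr_min_spec (l : List (List α)) (w : List α) :
    (l.foldr min w = w ∨ l.foldr min w ∈ l) ∧ ∀ y ∈ l, l.foldr min w ≤ y := by
  induction l with
  | nil => simp
  | cons a l ih =>
    simp only [List.foldr_cons]
    refine ⟨?_, ?_⟩
    · rcases min_choice a (l.foldr min w) with h | h <;> rw [h]
      · simp
      · rcases ih.1 with h' | h'
        · exact Or.inl h'
        · exact Or.inr (List.mem_cons_of_mem _ h')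
    · intro y hy
      rcases List.mem_cons.mp hy with rfl | hy
      · exact min_le_left _ _
      · exact (min_le_right _ _).trans (ih.2 y hy)

theorem foldr_max_spec (l : List (List α)) (w : List α) :
    (l.foldr max w = w ∨ l.foldr max w ∈ l) ∧ ∀ y ∈ l, y ≤ l.foldr max w := by
  induction l with
  | nil => simp
  | cons a l ih =>
    simp only [List.foldr_cons]
    refine ⟨?_, ?_⟩
    · rcases max_choice a (l.foldr max w) with h | h <;> rw [h]
      · simp
      · rcases ih.1 with h' | h'
        · exact Or.inl h'
        · exact Or.inr (List.mem_cons_of_mem _ h')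
    · intro y hy
      rcases List.mem_cons.mp hy with rfl | hy
      · exact le_max_left _ _
      · exact (ih.2 y hy).trans (le_max_right _ _)

theorem rotate_mem (w : List α) (hw : w ≠ []) (q : ℕ) :
    w.rotate q ∈ (List.range w.length).map w.rotate := by
  rw [List.mem_map]
  refine ⟨q % w.length, ?_, List.rotate_mod _ _⟩
  exact List.mem_range.mpr (Nat.mod_lt _ (List.length_pos_iff.mpr hw))

theorem minRot_spec (w : List α) (hw : w ≠ []) :
    (∃ m, minRot w = w.rotate m) ∧ ∀ q, minRot w ≤ w.rotate q := by
  obtain ⟨h1, h2⟩ := foldr_min_spec ((List.range w.length).map w.rotate) w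
  refine ⟨?_, fun q => h2 _ (rotate_mem w hw q)⟩
  rcases h1 with h | h
  · exact ⟨0, by rw [List.rotate_zero]; exact h⟩
  · obtain ⟨m, -, hm⟩ := List.mem_map.mp h
    exact ⟨m, hm.symm⟩

theorem maxRot_spec (w : List α) (hw : w ≠ []) :
    (∃ m, maxRot w = w.rotate m) ∧ ∀ q, w.rotate q ≤ maxRot w := by
  obtain ⟨h1, h2⟩ := foldr_max_spec ((List.range w.length).map w.rotate) w
  refine ⟨?_, fun q => h2 _ (rotate_mem w hw q)⟩
  rcases h1 with h | h
  · exact ⟨0, by rw [List.rotate_zero]; exact h⟩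
  · obtain ⟨m, -, hm⟩ := List.mem_map.mp h
    exact ⟨m, hm.symm⟩

theorem prim_rotate (w : List α) (hprim : ∀ q, 0 < q → q < w.length → w.rotate q ≠ w) (m : ℕ) :
    ∀ q, 0 < q → q < (w.rotate m).length → (w.rotate m).rotate q ≠ w.rotate m := by
  intro q hq hql h
  rw [List.length_rotate] at hql
  apply hprim q hq hql
  rw [List.rotate_rotate, Nat.add_comm, ← List.rotate_rotate] at h
  exact List.rotate_injective m h

/-- The key property of handles. -/
def Good (u : List α) (i j k : ℕ) : Prop :=
  i + minPeriod (factor u i j) ≤ k + 1 ∧ k + 1 + minPeriod (factor u i j) ≤ j + 1 ∧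
  ∀ q, 0 < q → q < minPeriod (factor u i j) →
    ¬ ∀ t < q, u[k + 1 + t]? = u[k + 1 + (minPeriod (factor u i j) - q + t)]?

theorem good_of_consec {u : List α} {i j : ℕ} (x : List α)
    (hx : Unbordered x) (hl : x.length = minPeriod (factor u i j))
    (hp : 0 < x.length) (s s' : ℕ) (hc : ConsecutiveOcc u i j x s s') :
    Good u i j (s' - 1) := by
  obtain ⟨⟨a1, a2, a3⟩, ⟨b1, b2, b3⟩, hlt, -⟩ := hc
  have occ : ∀ s, factor u s (s + x.length - 1) = x → ∀ t < x.length, u[s + t]? = x[t]? := by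
    intro s hs t ht
    rw [← factor_getElem? u s (s + x.length - 1) t (by omega), hs]
  have oa := occ s a3
  have ob := occ s' b3
  unfold Good
  rw [← hl]
  have hd : s + x.length ≤ s' := by
    by_contra hcon
    apply hx (x.length - (s' - s)) (by omega) (by omega)
    intro t ht
    rw [← ob t (by omega), ← oa _ (by omega)]
    congr 1; omega
  have e : s' - 1 + 1 = s' := by omega
  rw [e]
  refine ⟨by omega, by omega, fun q hq hqp hb => hx q hq hqp fun t ht => ?_⟩
  rw [← ob t (by omega), ← ob _ (by omega)]
  exact hb t ht

theorem good_of_handle {u : List α} {i j k : ℕ} (h : IsRun u i j) (hk : k ∈ handles u i j) :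
    Good u i j k := by
  have hprim := run_primitive h
  obtain ⟨hp, -⟩ := run_period h
  have h2 := h.2.2.1
  have hij := h.1
  have hj := h.2.1
  simp only [handles] at hk
  have hwl := factor_length u i (i + minPeriod (factor u i j) - 1) (by omega) (by omega)
  rw [show i + minPeriod (factor u i j) - 1 - i + 1 = minPeriod (factor u i j) by omega] at hwl
  obtain ⟨w, hw⟩ : ∃ w, w = factor u i (i + minPeriod (factor u i j) - 1) := ⟨_, rfl⟩
  rw [← hw] at hk hwl hprim
  have hne : w ≠ [] := by
    intro h0; rw [h0] at hwl; simp at hwl; omega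
  have hprim' : ∀ q, 0 < q → q < w.length → w.rotate q ≠ w := by
    intro q hq hqw; exact hprim q hq (by omega)
  obtain ⟨⟨m, hm⟩, hmin⟩ := minRot_spec w hne
  obtain ⟨⟨M, hM⟩, hmax⟩ := maxRot_spec w hne
  split_ifs at hk with hc
  · have hall : ∀ q, w.rotate q = minRot w := fun q =>
      le_antisymm (by rw [hc]; exact hmax q) (hmin q)
    have hp1 : minPeriod (factor u i j) = 1 := by
      by_contra hne1
      apply hprim 1 (by omega) (by omega)
      rw [hall 1, ← hall 0, List.rotate_zero]
    obtain ⟨k1, k2⟩ := hk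
    unfold Good
    rw [hp1]
    exact ⟨by omega, by omega, fun q hq hq1 => by omega⟩
  · obtain ⟨s, s', hcs, rfl⟩ := hk
    rcases hcs with hcs | hcs
    · refine good_of_consec (minRot w) ?_ (by rw [hm, List.length_rotate, hwl])
        (by rw [hm, List.length_rotate, hwl]; exact hp) s s' hcs
      apply unbordered_of_extremal
      · rw [hm]; exact prim_rotate w hprim' m
      · left; intro q
        conv_rhs => rw [hm, List.rotate_rotate]
        exact hmin _
    · refine good_of_consec (maxRot w) ?_ (by rw [hM, List.length_rotate, hwl])
        (by rw [hM, List.length_rotate, hwl]; exact hp) s s' hcs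
      apply unbordered_of_extremal
      · rw [hM]; exact prim_rotate w hprim' M
      · right; intro q
        conv_lhs => rw [hM, List.rotate_rotate]
        exact hmax _

theorem good_not_lt {u : List α} {i j i' j' k : ℕ} (h : IsRun u i j) (h' : IsRun u i' j')
    (g : Good u i j k) (g' : Good u i' j' k) :
    ¬ minPeriod (factor u i j) < minPeriod (factor u i' j') := by
  intro hlt
  obtain ⟨hp, hper⟩ := run_period h
  obtain ⟨hp', hper'⟩ := run_period h'
  obtain ⟨g1, g2, -⟩ := g
  obtain ⟨g1', g2', g3'⟩ := g'
  generalize minPeriod (factor u i j) = p at *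
  generalize minPeriod (factor u i' j') = p' at *
  apply g3' p hp hlt
  intro t ht
  have e1 := hper (k + 1 + t - p) (by omega) (by omega)
  have e2 := hper' (k + 1 + t - p) (by omega) (by omega)
  rw [show k + 1 + t - p + p = k + 1 + t by omega] at e1
  rw [show k + 1 + t - p + p' = k + 1 + (p' - p + t) by omega] at e2
  rw [← e1, e2]

theorem run_left_right {u : List α} {i j i' j' k : ℕ} (h : IsRun u i j) (h' : IsRun u i' j')
    (g : Good u i j k) (g' : Good u i' j' k)
    (hpp : minPeriod (factor u i j) = minPeriod (factor u i' j')) : ¬ i < i' ∧ ¬ j < j' := by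
  obtain ⟨hp, hper⟩ := run_period h
  obtain ⟨hp', hper'⟩ := run_period h'
  obtain ⟨g1, g2, -⟩ := g
  obtain ⟨g1', g2', -⟩ := g'
  obtain ⟨-, hj, -, -, hr⟩ := h
  obtain ⟨-, hj', -, hl', -⟩ := h'
  rw [← hpp] at hl' hp' hper' g1' g2'
  generalize minPeriod (factor u i j) = p at *
  constructor
  · intro hlt
    rcases hl' with h0 | h0
    · omega
    · apply h0
      rw [hper (i' - 1) (by omega) (by omega)]
      congr 1; omega
  · intro hlt
    rcases hr with h0 | h0
    · omega
    · apply h0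
      rw [hper' (j - p + 1) (by omega) (by omega)]
      congr 1; omega

theorem good_unique {u : List α} {i j i' j' k : ℕ} (h : IsRun u i j) (h' : IsRun u i' j')
    (g : Good u i j k) (g' : Good u i' j' k) : (i, j) = (i', j') := by
  have n1 := good_not_lt h h' g g'
  have n2 := good_not_lt h' h g' g
  have hpp : minPeriod (factor u i j) = minPeriod (factor u i' j') := by omega
  have a := run_left_right h h' g g' hpp
  have b := run_left_right h' h g' g hpp.symm
  rw [Prod.mk.injEq]; omega

end ord

/-- The sum of the numbers of handles over all runs of a word of length `n` is at
most `n - 1`. -/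
theorem sum_handles_card_le [LinearOrder α] (u : List α) :
    ∑ q ∈ runs u, (handles u q.1 q.2).ncard ≤ u.length - 1 := by
  have hrun : ∀ q ∈ runs u, IsRun u q.1 q.2 := fun q hq => (Finset.mem_filter.mp hq).2
  have hcard : ∀ q ∈ runs u, (handles u q.1 q.2).ncard =
      ((Finset.range (u.length - 1)).filter (fun k => k ∈ handles u q.1 q.2)).card := by
    intro q hq
    rw [← Set.ncard_coe_finset]
    congr 1
    ext k
    simp only [Finset.coe_filter, Finset.mem_range, Set.mem_setOf_eq]
    refine ⟨fun hk => ⟨?_, hk⟩, fun hk => hk.2⟩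
    have g := good_of_handle (hrun q hq) hk
    have hp := (run_period (hrun q hq)).1
    have h1 := g.2.1
    have h2 := (hrun q hq).2.1
    omega
  rw [Finset.sum_congr rfl hcard, ← Finset.card_biUnion]
  · calc _ ≤ (Finset.range (u.length - 1)).card := by
          apply Finset.card_le_card
          intro k hk
          obtain ⟨q, -, hk⟩ := Finset.mem_biUnion.mp hk
          exact (Finset.mem_filter.mp hk).1
      _ = _ := Finset.card_range _
  · intro q hq q' hq' hne
    rw [Finset.mem_coe] at hq hq'
    rw [Function.onFun, Finset.disjoint_left]
    intro k hk hk'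
    apply hne
    exact good_unique (hrun q hq) (hrun q' hq')
      (good_of_handle (hrun q hq) (Finset.mem_filter.mp hk).2)
      (good_of_handle (hrun q' hq') (Finset.mem_filter.mp hk').2)
end RunsExp
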